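/- For all integers j ≥ 1, k ≥ 1 and β ≥ 0, one has π(y^{(2k)}_{2β+2,j}) ≥ 2k + β + ⌊(5j - 5)/2⌋. -/

import Mathlib

open PowerSeries


/-- The Hirschhorn–Hunt matrix `m_{i,j}` (zero outside `1 ≤ j ≤ i`). -/
def mcoef : ℕ → ℕ → ℤ
  | 1, 1 => 5
  | 2, 1 => 2 * 5
  | 2, 2 => 5 ^ 3
  | 3, 1 => 9
  | 3, 2 => 3 * 5 ^ 3
  | 3, 3 => 5 ^ 5
  | 4, 1 => 4
  | 4, 2 => 22 * 5 ^ 2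
  | 4, 3 => 4 * 5 ^ 5
  | 4, 4 => 5 ^ 7
  | 5, 1 => 1
  | 5, 2 => 4 * 5 ^ 3
  | 5, 3 => 8 * 5 ^ 5
  | 5, 4 => 5 ^ 8
  | 5, 5 => 5 ^ 9
  | i + 6, j + 2 =>
      25 * mcoef (i + 5) (j + 1) + 25 * mcoef (i + 4) (j + 1) +
        15 * mcoef (i + 3) (j + 1) + 5 * mcoef (i + 2) (j + 1) + mcoef (i + 1) (j + 1)
  | _, _ => 0

/-- The Hirschhorn–Hunt coefficient vectors: `xcoef k i = x_{k,i}`.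
`x_1 = (5, 0, 0, …)` and `x_{k+1,i} = Σ_{j ≥ 1} x_{k,j} m_{6j,j+i}` for odd `k`,
`x_{k+1,i} = Σ_{j ≥ 1} x_{k,j} m_{6j+1,j+i}` for even `k` (the sums are finitely
supported, and `∑ᶠ` sums over `j + 1` for `j : ℕ`, i.e. over all `j ≥ 1`). -/
noncomputable def xcoef : ℕ → ℕ → ℤ
  | 0, _ => 0
  | 1, j => if j = 1 then 5 else 0
  | k + 2, i =>
      if (k + 1) % 2 = 1 then
        ∑ᶠ j : ℕ, xcoef (k + 1) (j + 1) * mcoef (6 * (j + 1)) ((j + 1) + i)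
      else
        ∑ᶠ j : ℕ, xcoef (k + 1) (j + 1) * mcoef (6 * (j + 1) + 1) ((j + 1) + i)

/-- `yeven k β j = y^{(2k)}_{β,j}`: `y^{(2k)}_{1,j} = x_{2k-1,j}` and
`y^{(2k)}_{β+1,j} = Σ_{i ≥ 1} y^{(2k)}_{β,i} m_{6i,j+i}` for odd `β`,
`y^{(2k)}_{β+1,j} = Σ_{i ≥ 1} y^{(2k)}_{β,i} m_{6i+2,j+i}` for even `β`. -/
noncomputable def yeven (k : ℕ) : ℕ → ℕ → ℤ
  | 0, _ => 0
  | 1, j => xcoef (2 * k - 1) j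
  | β + 2, j =>
      if (β + 1) % 2 = 1 then
        ∑ᶠ i : ℕ, yeven k (β + 1) (i + 1) * mcoef (6 * (i + 1)) (j + (i + 1))
      else
        ∑ᶠ i : ℕ, yeven k (β + 1) (i + 1) * mcoef (6 * (i + 1) + 2) (j + (i + 1))

/-- The 5-adic lower bound `π(m_{i,j}) ≥ ⌊(5j - i - 1)/2⌋`. -/
theorem pow_dvd_mcoef (i j : ℕ) : (5 : ℤ) ^ ((5 * j - i - 1) / 2) ∣ mcoef i j := by
  fun_induction mcoef i j with
  | case16 i j h1 h2 h3 h4 h5 =>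
    have scale {a b c d : ℕ} {z : ℤ} (h : (5 : ℤ) ^ a ∣ z) (hd : d ≤ b + a) :
        (5 : ℤ) ^ d ∣ c * 5 ^ b * z := by
      rw [mul_assoc]
      exact ((pow_dvd_pow 5 hd).trans (pow_add (5 : ℤ) b a ▸ mul_dvd_mul_left _ h)).mul_left _
    have e1 := scale (b := 2) (c := 1) (d := (5 * (j + 2) - (i + 6) - 1) / 2) h1 (by omega)
    have e2 := scale (b := 2) (c := 1) (d := (5 * (j + 2) - (i + 6) - 1) / 2) h2 (by omega)
    have e3 := scale (b := 1) (c := 3) (d := (5 * (j + 2) - (i + 6) - 1) / 2) h3 (by omega)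
    have e4 := scale (b := 1) (c := 1) (d := (5 * (j + 2) - (i + 6) - 1) / 2) h4 (by omega)
    have e5 := scale (b := 0) (c := 1) (d := (5 * (j + 2) - (i + 6) - 1) / 2) h5 (by omega)
    norm_num at e1 e2 e3 e4 e5
    exact dvd_add (dvd_add (dvd_add (dvd_add e1 e2) e3) e4) e5
  | case17 => exact dvd_zero _
  | _ => norm_num

theorem dvd_finsum {ι R : Type*} [Semiring R] {a : R} {f : ι → R} (h : ∀ i, a ∣ f i) :
    a ∣ ∑ᶠ i, f i :=
  finsum_induction (a ∣ ·) (dvd_zero a) (fun _ _ => dvd_add) h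

/-- Applying the matrix `(m_{6j+r, j+i})` with `r ≤ 2` preserves 5-adic bounds of the form
`c + ⌊(5j - 5)/2⌋`, and raises `c` by one when `r ≤ 1`. -/
theorem pow_dvd_finsum_mul_mcoef {u : ℕ → ℤ} {c d r i : ℕ} (hi : 1 ≤ i)
    (hr : r ≤ 1 ∧ d ≤ c + 1 ∨ r ≤ 2 ∧ d ≤ c)
    (hu : ∀ j, 1 ≤ j → (5 : ℤ) ^ (c + (5 * j - 5) / 2) ∣ u j) :
    (5 : ℤ) ^ (d + (5 * i - 5) / 2) ∣
      ∑ᶠ j : ℕ, u (j + 1) * mcoef (6 * (j + 1) + r) ((j + 1) + i) := by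
  refine dvd_finsum fun j => ?_
  have h := mul_dvd_mul (hu (j + 1) (by omega))
    (pow_dvd_mcoef (6 * (j + 1) + r) ((j + 1) + i))
  rw [← pow_add] at h
  refine (pow_dvd_pow 5 ?_).trans h
  rcases Nat.eq_zero_or_pos j with rfl | hj <;> rcases hr with hr | hr <;> omega

theorem pow_dvd_xcoef_odd (k j : ℕ) (hj : 1 ≤ j) :
    (5 : ℤ) ^ (2 * k + 1 + (5 * j - 5) / 2) ∣ xcoef (2 * k + 1) j := by
  induction k generalizing j with
  | zero =>
    rw [mul_zero, zero_add, xcoef]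
    split_ifs with h
    · simp [h]
    · exact dvd_zero _
  | succ k ih =>
    have hx (i : ℕ) (hi : 1 ≤ i) :
        (5 : ℤ) ^ (2 * k + 2 + (5 * i - 5) / 2) ∣ xcoef (2 * k + 2) i := by
      rw [xcoef, if_pos (by omega)]
      exact pow_dvd_finsum_mul_mcoef (r := 0) hi (by omega) ih
    rw [show 2 * (k + 1) + 1 = 2 * k + 1 + 2 by ring, xcoef, if_neg (by omega)]
    exact pow_dvd_finsum_mul_mcoef hj (by omega) hx

theorem pow_dvd_yeven_even {k β : ℕ}
    (hy : ∀ j, 1 ≤ j → (5 : ℤ) ^ (2 * k - 1 + β + (5 * j - 5) / 2) ∣ yeven k (2 * β + 1) j)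
    (j : ℕ) (hj : 1 ≤ j) :
    (5 : ℤ) ^ (2 * k + β + (5 * j - 5) / 2) ∣ yeven k (2 * β + 2) j := by
  rw [yeven, if_pos (by omega)]
  simp_rw [add_comm j]
  exact pow_dvd_finsum_mul_mcoef (r := 0) hj (by omega) hy

theorem pow_dvd_yeven_odd {k : ℕ} (hk : 1 ≤ k) (β j : ℕ) (hj : 1 ≤ j) :
    (5 : ℤ) ^ (2 * k - 1 + β + (5 * j - 5) / 2) ∣ yeven k (2 * β + 1) j := by
  induction β generalizing j with
  | zero =>
    obtain ⟨l, rfl⟩ := Nat.exists_eq_add_of_le' hk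
    exact pow_dvd_xcoef_odd l j hj
  | succ β ih =>
    rw [show 2 * (β + 1) + 1 = 2 * β + 1 + 2 by ring, yeven, if_neg (by omega)]
    simp_rw [add_comm j]
    exact pow_dvd_finsum_mul_mcoef hj (by omega) (pow_dvd_yeven_even ih)

/-- Lemma 4.4, Eq. (4.4): `π(y^{(2k)}_{2β+2,j}) ≥ 2k + β + ⌊(5j-5)/2⌋` where `π`
is the 5-adic valuation (with `π(0) = +∞`). -/
theorem val_yeven_b (j k β : ℕ) (hj : 1 ≤ j) (hk : 1 ≤ k) :
    ((2 * k + β + (5 * j - 5) / 2 : ℕ) : ℕ∞) ≤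
      emultiplicity (5 : ℤ) (yeven k (2 * β + 2) j) := by
  exact le_emultiplicity_of_pow_dvd (pow_dvd_yeven_even (pow_dvd_yeven_odd hk β) j hj)
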